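/- (Polynomial entropy comes from singular sets.) In the standing setting, for every nonempty finite subset S of X∖{∞}: h^loc_pol(f; S) = max { h^loc_pol(f; S') : S' ⊆ S, S' nonempty and singular }. -/

import Mathlib

open Filter Topology Set
open scoped ENNReal

/-- `E` is `(n, ε)`-separated for `f`: any two distinct points of `E` are `ε`-apart at some
time `k ∈ {0, …, n-1}`. -/
def IsDynSeparated {X : Type*} [MetricSpace X] (f : X → X) (n : ℕ) (ε : ℝ) (E : Set X) : Prop :=
  ∀ x ∈ E, ∀ y ∈ E, x ≠ y → ∃ k < n, ε < dist (f^[k] x) (f^[k] y)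

/-- `S(n, ε)`: the maximal cardinality of an `(n, ε)`-separated set. -/
noncomputable def maxSep {X : Type*} [MetricSpace X] (f : X → X) (n : ℕ) (ε : ℝ) : ℕ :=
  sSup {m | ∃ E : Finset X, IsDynSeparated f n ε ↑E ∧ E.card = m}

/-- Polynomial entropy `h_pol(f) = lim_{ε → 0} limsup_n (log S(n,ε) / log n)`, a value in
`[0, ∞]`.  Since `ε ↦ limsup_n (log S(n,ε) / log n)` is nonincreasing in `ε`, the limit as
`ε → 0⁺` is the supremum over `ε > 0`. -/
noncomputable def polEntropy {X : Type*} [MetricSpace X] (f : X → X) : ℝ≥0∞ :=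
  ⨆ (ε : ℝ) (_ : 0 < ε),
    Filter.atTop.limsup fun n : ℕ =>
      ENNReal.ofReal (Real.log (maxSep f n ε) / Real.log n)

/-- Topological entropy `h_top(f) = lim_{ε → 0} limsup_n (1/n) log S(n,ε)`. -/
noncomputable def topEntropy {X : Type*} [MetricSpace X] (f : X → X) : ℝ≥0∞ :=
  ⨆ (ε : ℝ) (_ : 0 < ε),
    Filter.atTop.limsup fun n : ℕ =>
      ENNReal.ofReal (Real.log (maxSep f n ε) / n)

/-- The set `A_n(ℱ)` of codings of orbit segments of length `n` relative to the finite
family `ℱ`: words `w` with letters in `ℱ ∪ {∞_ℱ}` (where `∞_ℱ` is the complement of `∪ℱ`)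
for which some orbit segment `(x, f x, …, f^{n-1} x)` satisfies `f^k x ∈ w k` for all `k`. -/
def codings {X : Type*} (f : X → X) (F : Finset (Set X)) (n : ℕ) : Set (Fin n → Set X) :=
  {w | (∀ k, w k ∈ F ∨ w k = (⋃₀ (F : Set (Set X)))ᶜ) ∧
      ∃ x : X, ∀ k : Fin n, f^[(k : ℕ)] x ∈ w k}

/-- Coding polynomial entropy of a finite family: `h_pol(f; ℱ) = limsup_n log #A_n(ℱ) / log n`.
For a single set `Y`, `h_pol(f; Y)` is `codingEntropy f {Y}`. -/
noncomputable def codingEntropy {X : Type*} (f : X → X) (F : Finset (Set X)) : ℝ≥0∞ :=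
  Filter.atTop.limsup fun n : ℕ =>
    ENNReal.ofReal (Real.log ((codings f F n).ncard) / Real.log n)

/-- The `n`-th iterate of a homeomorphism, for `n : ℤ`. -/
def zIter {X : Type*} [TopologicalSpace X] (f : X ≃ₜ X) (n : ℤ) (x : X) : X :=
  (f.toEquiv ^ n) x

/-- A set `Z` is wandering if `f^n(Z) ∩ Z = ∅` for every integer `n ≠ 0`. -/
def IsWanderingSet {X : Type*} [TopologicalSpace X] (f : X ≃ₜ X) (Z : Set X) : Prop :=
  ∀ n : ℤ, n ≠ 0 → zIter f n '' Z ∩ Z = ∅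

/-- Standing setting: `p` (the point written `∞` in the paper) is a fixed point of `f`, and
every other point is wandering, i.e. has a wandering neighborhood. -/
def StandingSetting {X : Type*} [TopologicalSpace X] (f : X ≃ₜ X) (p : X) : Prop :=
  f p = p ∧ ∀ x : X, x ≠ p → ∃ U ∈ 𝓝 x, IsWanderingSet f U

/-- `M(Y) = sup_{x ∈ X} #{n ∈ ℤ : f^n(x) ∈ Y}`. -/
noncomputable def orbitCount {X : Type*} [TopologicalSpace X] (f : X ≃ₜ X) (Y : Set X) : ℕ∞ :=
  ⨆ x : X, {n : ℤ | zIter f n x ∈ Y}.encard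

/-- Local polynomial entropy `h^loc_pol(f; S)` of a finite set `S`: the limit, along
decreasing neighborhood bases of the points of `S`, of the coding entropies of the
corresponding families of neighborhoods.  By monotonicity of the coding entropy this limit
equals the infimum of `h_pol(f; {U x : x ∈ S})` over all families `U` of respective
neighborhoods of the points of `S` such that `M(⋃_{x ∈ S} U x) < ∞` (such families exist,
and any decreasing neighborhood basis eventually consists of such sets). -/
noncomputable def localEntropy {X : Type*} [TopologicalSpace X] (f : X ≃ₜ X)
    (S : Finset X) : ℝ≥0∞ :=
  letI := Classical.decEq (Set X)
  ⨅ (U : X → Set X) (_ : ∀ x ∈ S, U x ∈ 𝓝 x)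
    (_ : orbitCount f (⋃ x ∈ S, U x) < ⊤),
    codingEntropy ⇑f (S.image U)

/-- The family `U` of sets (indexed by the points of `S`) is mutually singular: for every
`M` there are a point `x` and times `(N a)_{a ∈ S}` with `f^{N a}(x) ∈ U a` for all `a ∈ S`
and `|N a - N b| > M` for all `a ≠ b` in `S`. -/
def MutuallySingularFam {X : Type*} [TopologicalSpace X] (f : X ≃ₜ X) (S : Finset X)
    (U : X → Set X) : Prop :=
  ∀ M : ℕ, ∃ (x : X) (N : X → ℤ),
    (∀ a ∈ S, zIter f (N a) x ∈ U a) ∧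
    ∀ a ∈ S, ∀ b ∈ S, a ≠ b → (M : ℤ) < |N a - N b|

/-- A finite set `S` is singular if every family of respective neighborhoods of its points
is mutually singular. -/
def IsSingularSet {X : Type*} [TopologicalSpace X] (f : X ≃ₜ X) (S : Finset X) : Prop :=
  ∀ U : X → Set X, (∀ a ∈ S, U a ∈ 𝓝 a) → MutuallySingularFam f S U

open Classical in
/-- Words that are constant outside the `M`-neighborhood of the marked positions of words in `B`
are at most a constant times as numerous as the words in `B`. -/
lemma ncard_words_le {X : Type*} {n : ℕ} (p : X) (A B : Set (Fin n → Set X))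
    (L : Finset (Set X)) (c : Set X) (M m : ℕ) (hB : B.Finite)
    (hL : ∀ w ∈ A, ∀ k, w k ∈ L) (hc : ∀ w ∈ A, ∀ k, p ∈ w k → w k = c)
    (hm : ∀ v ∈ B, (Finset.univ.filter fun j => p ∉ v j).card ≤ m)
    (hAB : ∀ w ∈ A, ∃ v ∈ B, ∀ k, p ∉ w k →
      ∃ j, p ∉ v j ∧ (k : ℕ) ≤ j + M ∧ (j : ℕ) ≤ k + M) :
    A.ncard ≤ B.ncard * (L.card + 1) ^ (m * (2 * M + 1)) := by
  let P : (Fin n → Set X) → Finset (Fin n) := fun v =>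
    (Finset.univ.filter fun j => p ∉ v j).biUnion fun j =>
      Finset.univ.filter fun k : Fin n => (k : ℕ) ≤ j + M ∧ (j : ℕ) ≤ k + M
  have hP : ∀ v ∈ B, (P v).card ≤ m * (2 * M + 1) := by
    intro v hv
    refine (Finset.card_biUnion_le_card_mul _ _ (2 * M + 1) ?_).trans
      (Nat.mul_le_mul_right _ (hm v hv))
    intro j _
    rw [← Finset.card_map Fin.valEmbedding]
    refine (Finset.card_le_card (t := Finset.Icc (j - M : ℕ) (j + M)) ?_).trans ?_
    · intro k hk
      simp only [Finset.mem_map, Finset.mem_filter, Finset.mem_univ, true_and] at hk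
      obtain ⟨k, hk, rfl⟩ := hk
      simp only [Fin.valEmbedding_apply, Finset.mem_Icc]
      omega
    · rw [Nat.card_Icc]
      omega
  let Q : (Fin n → Set X) → Finset (Fin n → Set X) := fun v =>
    Fintype.piFinset fun k => if k ∈ P v then L else {c}
  have hQ : ∀ v ∈ hB.toFinset, (Q v).card ≤ (L.card + 1) ^ (m * (2 * M + 1)) := by
    intro v hv
    have h : (Q v).card ≤ ∏ k : Fin n, if k ∈ P v then (L.card + 1) else 1 := by
      rw [Fintype.card_piFinset]
      refine Finset.prod_le_prod' fun k _ => ?_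
      split_ifs <;> simp
    refine h.trans ?_
    rw [Finset.prod_ite_mem, Finset.prod_const, Finset.univ_inter]
    exact Nat.pow_le_pow_right (Nat.succ_pos _) (hP v (hB.mem_toFinset.1 hv))
  have hsub : A ⊆ (hB.toFinset.biUnion Q : Finset (Fin n → Set X)) := by
    intro w hw
    obtain ⟨v, hv, hwv⟩ := hAB w hw
    simp only [Finset.coe_biUnion, Set.mem_iUnion]
    refine ⟨v, by simpa using hv, ?_⟩
    simp only [Q, Finset.mem_coe, Fintype.mem_piFinset]
    intro k
    split_ifs with hk
    · exact hL w hw k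
    · refine Finset.mem_singleton.2 (hc w hw k ?_)
      by_contra hp
      obtain ⟨j, hj, hkj⟩ := hwv k hp
      exact hk (Finset.mem_biUnion.2 ⟨j, by simpa using hj, by simpa using hkj⟩)
  calc A.ncard ≤ (hB.toFinset.biUnion Q).card := by
        rw [← Set.ncard_coe_finset]
        exact Set.ncard_le_ncard hsub (Finset.finite_toSet _)
    _ ≤ hB.toFinset.card * (L.card + 1) ^ (m * (2 * M + 1)) :=
        Finset.card_biUnion_le_card_mul _ _ _ hQ
    _ = _ := by rw [Set.ncard_eq_toFinset_card B hB]

lemma codings_finite {X : Type*} (f : X → X) (F : Finset (Set X)) (n : ℕ) :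
    (codings f F n).Finite := by
  refine (Set.Finite.pi' (t := fun _ : Fin n =>
    insert (⋃₀ (F : Set (Set X)))ᶜ (F : Set (Set X)))
    fun _ => F.finite_toSet.insert _).subset ?_
  intro w hw k
  rcases hw.1 k with h | h
  · exact Or.inr h
  · exact Or.inl h

/-- Every orbit segment has a coding. -/
lemma exists_coding {X : Type*} (f : X → X) (F : Finset (Set X)) (n : ℕ) (x : X) :
    ∃ w ∈ codings f F n, ∀ k : Fin n, f^[(k : ℕ)] x ∈ w k := by
  have h : ∀ k : Fin n, ∃ s : Set X, (s ∈ F ∨ s = (⋃₀ (F : Set (Set X)))ᶜ) ∧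
      f^[(k : ℕ)] x ∈ s := by
    intro k
    by_cases hk : f^[(k : ℕ)] x ∈ ⋃₀ (F : Set (Set X))
    · obtain ⟨s, hs, hxs⟩ := hk
      exact ⟨s, Or.inl hs, hxs⟩
    · exact ⟨_, Or.inr rfl, hk⟩
  choose w hw hx using h
  exact ⟨w, ⟨hw, x, hx⟩, hx⟩

lemma codings_ncard_pos {X : Type*} [Nonempty X] (f : X → X) (F : Finset (Set X)) (n : ℕ) :
    0 < (codings f F n).ncard := by
  obtain ⟨w, hw, -⟩ := exists_coding f F n (Classical.arbitrary X)
  exact (Set.ncard_pos (codings_finite f F n)).2 ⟨w, hw⟩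

lemma mem_letter_iff {X : Type*} {F : Finset (Set X)} {p y : X} {s : Set X}
    (hp : p ∉ ⋃₀ (F : Set (Set X))) (hs : s ∈ F ∨ s = (⋃₀ (F : Set (Set X)))ᶜ) (hy : y ∈ s) :
    p ∉ s ↔ y ∈ ⋃₀ (F : Set (Set X)) := by
  rcases hs with hs | rfl
  · exact ⟨fun _ => ⟨s, hs, hy⟩, fun _ h => hp ⟨s, hs, h⟩⟩
  · simp only [Set.mem_compl_iff, not_not] at hy ⊢
    exact ⟨fun h => absurd h hp, fun h => absurd h hy⟩

/-- Counting bounds up to a multiplicative constant and finitely many alternatives give bounds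
on coding entropies. -/
lemma codingEntropy_le_of_ncard_le {X ι : Type*} [Nonempty X] (f : X → X) (G : Finset (Set X))
    (I : Finset ι) (F : ι → Finset (Set X)) (D : ℕ)
    (h : ∀ n, (codings f G n).ncard ≤ (∑ i ∈ I, (codings f (F i) n).ncard) * D) :
    ∃ i ∈ I, codingEntropy f G ≤ codingEntropy f (F i) := by
  have hI : I.Nonempty := by
    by_contra hI
    rw [Finset.not_nonempty_iff_eq_empty] at hI
    have := h 0
    have := codings_ncard_pos f G 0
    simp_all
  obtain ⟨i₀, hi₀, hmax⟩ := Finset.exists_max_image I (fun i => codingEntropy f (F i)) hI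
  refine ⟨i₀, hi₀, le_of_forall_gt fun c hc => ?_⟩
  obtain ⟨d, hd, hdc⟩ := exists_between hc
  refine lt_of_le_of_lt ?_ hdc
  have hev : ∀ᶠ n : ℕ in atTop, ∀ i ∈ I,
      ENNReal.ofReal (Real.log ((codings f (F i) n).ncard) / Real.log n) < d := by
    rw [Finset.eventually_all]
    intro i hi
    exact Filter.eventually_lt_of_limsup_lt (lt_of_le_of_lt (hmax i hi) hd)
  have hlim : Tendsto (fun n : ℕ => ENNReal.ofReal (Real.log ((I.card * D : ℕ) : ℝ) / Real.log n) + d)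
      atTop (𝓝 d) := by
    have h1 : Tendsto (fun n : ℕ => Real.log ((I.card * D : ℕ) : ℝ) / Real.log n) atTop (𝓝 0) :=
      (Real.tendsto_log_atTop.comp tendsto_natCast_atTop_atTop).const_div_atTop _
    have h2 := (ENNReal.tendsto_ofReal h1).add_const d
    simpa using h2
  rw [← hlim.limsup_eq]
  refine Filter.limsup_le_limsup ?_
  filter_upwards [hev] with n hn
  obtain ⟨j, hj, hjmax⟩ := Finset.exists_max_image I (fun i => (codings f (F i) n).ncard) hI
  have h1 : (codings f G n).ncard ≤ (I.card * D) * (codings f (F j) n).ncard := by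
    refine (h n).trans ?_
    calc _ ≤ (I.card • (codings f (F j) n).ncard) * D :=
          Nat.mul_le_mul_right _ (Finset.sum_le_card_nsmul _ _ _ hjmax)
      _ = _ := by rw [smul_eq_mul]; ring
  have hpos := codings_ncard_pos f G n
  have hpos' := codings_ncard_pos f (F j) n
  have hD : 0 < I.card * D := Nat.pos_of_mul_pos_right (hpos.trans_le h1)
  have h2 : Real.log ((codings f G n).ncard) ≤
      Real.log ((I.card * D : ℕ) : ℝ) + Real.log ((codings f (F j) n).ncard) := by
    rw [← Real.log_mul (by positivity) (by positivity)]
    exact Real.log_le_log (by exact_mod_cast hpos) (by exact_mod_cast h1)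
  have h3 : (0 : ℝ) ≤ Real.log n := Real.log_natCast_nonneg n
  calc _ ≤ ENNReal.ofReal (Real.log ((I.card * D : ℕ) : ℝ) / Real.log n +
        Real.log ((codings f (F j) n).ncard) / Real.log n) := by
        refine ENNReal.ofReal_le_ofReal ?_
        rw [← add_div]
        exact div_le_div_of_nonneg_right h2 h3
    _ ≤ _ := ENNReal.ofReal_add_le
    _ ≤ _ := by gcongr; exact (hn j hj).le

lemma zIter_natCast {X : Type*} [TopologicalSpace X] (f : X ≃ₜ X) (k : ℕ) (x : X) :
    zIter f k x = f^[k] x := by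
  rw [zIter, zpow_natCast, ← Equiv.Perm.iterate_eq_pow]
  rfl

lemma orbitCount_mono {X : Type*} [TopologicalSpace X] (f : X ≃ₜ X) {Y Z : Set X} (h : Y ⊆ Z) :
    orbitCount f Y ≤ orbitCount f Z :=
  iSup_mono fun _ => Set.encard_le_encard fun _ hn => h hn

lemma orbitCount_union_le {X : Type*} [TopologicalSpace X] (f : X ≃ₜ X) (Y Z : Set X) :
    orbitCount f (Y ∪ Z) ≤ orbitCount f Y + orbitCount f Z := by
  refine iSup_le fun x => ?_
  have h : {n : ℤ | zIter f n x ∈ Y ∪ Z} = {n | zIter f n x ∈ Y} ∪ {n | zIter f n x ∈ Z} := rfl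
  rw [h]
  exact (Set.encard_union_le _ _).trans (add_le_add
    (le_iSup (fun x => {n : ℤ | zIter f n x ∈ Y}.encard) x)
    (le_iSup (fun x => {n : ℤ | zIter f n x ∈ Z}.encard) x))

lemma orbitCount_biUnion_lt_top {X : Type*} [TopologicalSpace X] (f : X ≃ₜ X) (S : Finset X)
    (U : X → Set X) (h : ∀ a ∈ S, orbitCount f (U a) < ⊤) :
    orbitCount f (⋃ a ∈ S, U a) < ⊤ := by
  classical
  induction S using Finset.induction_on with
  | empty => simp [orbitCount]
  | insert a s _ ih =>
    rw [Finset.set_biUnion_insert]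
    refine (orbitCount_union_le f _ _).trans_lt (WithTop.add_lt_top.2 ⟨?_, ?_⟩)
    · exact h a (Finset.mem_insert_self _ _)
    · exact ih fun b hb => h b (Finset.mem_insert_of_mem hb)

lemma notMem_of_orbitCount_lt_top {X : Type*} [TopologicalSpace X] (f : X ≃ₜ X) {p : X}
    (hp : f p = p) {Y : Set X} (h : orbitCount f Y < ⊤) : p ∉ Y := by
  intro hpY
  have hfin : {n : ℤ | zIter f n p ∈ Y}.encard < ⊤ :=
    (le_iSup (fun x => {n : ℤ | zIter f n x ∈ Y}.encard) p).trans_lt h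
  rw [Set.encard_lt_top_iff] at hfin
  refine Set.infinite_range_of_injective (Nat.cast_injective (R := ℤ)) (hfin.subset ?_)
  rintro _ ⟨n, rfl⟩
  change zIter f n p ∈ Y
  rwa [zIter_natCast, Function.iterate_fixed hp]

/-- If, up to a bounded time shift, every orbit segment visits `⋃₀ (F i)` whenever it visits
`⋃₀ G`, for some `i ∈ I` depending on the segment, then the coding entropy of `G` is at most that
of some `F i`. -/
lemma codingEntropy_le_of_visits {X ι : Type*} [TopologicalSpace X] (f : X ≃ₜ X) {p : X}
    (hp : f p = p) (G : Finset (Set X)) (I : Finset ι) (F : ι → Finset (Set X)) (M : ℕ)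
    (hG : orbitCount f (⋃₀ (G : Set (Set X))) < ⊤)
    (hF : ∀ i ∈ I, orbitCount f (⋃₀ (F i : Set (Set X))) < ⊤)
    (h : ∀ (n : ℕ) (x : X), ∃ i ∈ I, ∀ k < n, f^[k] x ∈ ⋃₀ (G : Set (Set X)) →
      ∃ j < n, f^[j] x ∈ ⋃₀ (F i : Set (Set X)) ∧ k ≤ j + M ∧ j ≤ k + M) :
    ∃ i ∈ I, codingEntropy f G ≤ codingEntropy f (F i) := by
  classical
  have : Nonempty X := ⟨p⟩
  have hpG := notMem_of_orbitCount_lt_top f hp hG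
  have hpF := fun i hi => notMem_of_orbitCount_lt_top f hp (hF i hi)
  let m : ℕ := I.sup fun i => (orbitCount f (⋃₀ (F i : Set (Set X)))).toNat
  have hm : ∀ i ∈ I, orbitCount f (⋃₀ (F i : Set (Set X))) ≤ m := by
    intro i hi
    rw [← ENat.natCast_toNat (hF i hi).ne]
    exact_mod_cast Finset.le_sup (f := fun i => (orbitCount f (⋃₀ (F i : Set (Set X)))).toNat) hi
  let L : Finset (Set X) := insert (⋃₀ (G : Set (Set X)))ᶜ G
  refine codingEntropy_le_of_ncard_le f G I F ((L.card + 1) ^ (m * (2 * M + 1))) fun n => ?_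
  have hfin : (⋃ i ∈ I, codings f (F i) n).Finite :=
    I.finite_toSet.biUnion fun i _ => codings_finite f (F i) n
  refine (ncard_words_le p (codings f G n) (⋃ i ∈ I, codings f (F i) n) L
    (⋃₀ (G : Set (Set X)))ᶜ M m hfin ?_ ?_ ?_ ?_).trans
    (Nat.mul_le_mul_right _ (Finset.set_ncard_biUnion_le _ _))
  · intro w hw k
    rcases hw.1 k with hk | hk
    · exact Finset.mem_insert_of_mem hk
    · rw [hk]
      exact Finset.mem_insert_self _ _
  · intro w hw k hk
    exact (hw.1 k).resolve_left fun hwG => hpG (Set.mem_sUnion.2 ⟨w k, hwG, hk⟩)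
  · intro v hv
    simp only [Set.mem_iUnion] at hv
    obtain ⟨i, hi, hv, x, hx⟩ := hv
    have hle : {t : ℤ | zIter f t x ∈ ⋃₀ (F i : Set (Set X))}.encard ≤ m :=
      (le_iSup (fun x => {t : ℤ | zIter f t x ∈ ⋃₀ (F i : Set (Set X))}.encard) x).trans (hm i hi)
    have himg : (fun j : Fin n => ((j : ℕ) : ℤ)) '' {j | p ∉ v j} ⊆
        {t : ℤ | zIter f t x ∈ ⋃₀ (F i : Set (Set X))} := by
      rintro _ ⟨j, hj, rfl⟩
      change zIter f ((j : ℕ) : ℤ) x ∈ ⋃₀ (F i : Set (Set X))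
      rw [zIter_natCast]
      exact (mem_letter_iff (hpF i hi) (hv j) (hx j)).1 hj
    have hinj : Function.Injective fun j : Fin n => ((j : ℕ) : ℤ) :=
      Nat.cast_injective.comp Fin.val_injective
    have hcard := (Set.encard_le_encard himg).trans hle
    rw [hinj.encard_image] at hcard
    have hcoe : {j | p ∉ v j} = ((Finset.univ.filter fun j => p ∉ v j : Finset (Fin n)) : Set _) := by
      ext
      simp
    rw [hcoe, Set.encard_coe_eq_coe_finsetCard] at hcard
    exact_mod_cast hcard
  · rintro w ⟨hw, x, hx⟩
    obtain ⟨i, hi, hvis⟩ := h n x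
    obtain ⟨v, hv, hxv⟩ := exists_coding f (F i) n x
    refine ⟨v, Set.mem_biUnion hi hv, fun k hk => ?_⟩
    obtain ⟨j, hj, hjF, hkj⟩ := hvis k k.2 ((mem_letter_iff hpG (hw k) (hx k)).1 hk)
    exact ⟨⟨j, hj⟩, (mem_letter_iff (hpF i hi) (hv.1 ⟨j, hj⟩) (hxv ⟨j, hj⟩)).2 hjF, hkj⟩

/-- Coding entropy is monotone in the union of the family. -/
lemma codingEntropy_mono {X : Type*} [TopologicalSpace X] (f : X ≃ₜ X) {p : X} (hp : f p = p)
    {G F : Finset (Set X)} (hGF : ⋃₀ (G : Set (Set X)) ⊆ ⋃₀ (F : Set (Set X)))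
    (hF : orbitCount f (⋃₀ (F : Set (Set X))) < ⊤) :
    codingEntropy f G ≤ codingEntropy f F := by
  obtain ⟨-, -, h⟩ := codingEntropy_le_of_visits f hp G {()} (fun _ => F) 0
    ((orbitCount_mono f hGF).trans_lt hF) (fun _ _ => hF)
    (fun n x => ⟨(), by simp, fun k hk hx => ⟨k, hk, hGF hx, by simp, by simp⟩⟩)
  exact h

/-- The finite family of sets `U a`, `a ∈ S`. -/
noncomputable def imageFamily {X : Type*} (U : X → Set X) (S : Finset X) : Finset (Set X) :=
  letI := Classical.decEq (Set X)
  S.image U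

lemma sUnion_imageFamily {X : Type*} (U : X → Set X) (S : Finset X) :
    ⋃₀ (imageFamily U S : Set (Set X)) = ⋃ a ∈ S, U a := by
  let := Classical.decEq (Set X)
  simp [imageFamily]

lemma localEntropy_le {X : Type*} [TopologicalSpace X] (f : X ≃ₜ X) (S : Finset X)
    (U : X → Set X) (hU : ∀ a ∈ S, U a ∈ 𝓝 a) (hfin : orbitCount f (⋃ a ∈ S, U a) < ⊤) :
    localEntropy f S ≤ codingEntropy f (imageFamily U S) :=
  iInf_le_of_le U (iInf_le_of_le hU (iInf_le_of_le hfin le_rfl))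

lemma exists_of_localEntropy_lt {X : Type*} [TopologicalSpace X] (f : X ≃ₜ X) (S : Finset X)
    {c : ℝ≥0∞} (h : localEntropy f S < c) :
    ∃ U : X → Set X, (∀ a ∈ S, U a ∈ 𝓝 a) ∧ orbitCount f (⋃ a ∈ S, U a) < ⊤ ∧
      codingEntropy f (imageFamily U S) < c := by
  simp only [localEntropy, iInf_lt_iff] at h
  obtain ⟨U, hU, hfin, hc⟩ := h
  exact ⟨U, hU, hfin, hc⟩

lemma localEntropy_mono {X : Type*} [TopologicalSpace X] (f : X ≃ₜ X) {p : X} (hp : f p = p)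
    {T S : Finset X} (hTS : T ⊆ S) : localEntropy f T ≤ localEntropy f S := by
  refine le_of_forall_gt fun c hc => ?_
  obtain ⟨U, hU, hfin, hc⟩ := exists_of_localEntropy_lt f S hc
  have hsub : ⋃ a ∈ T, U a ⊆ ⋃ a ∈ S, U a := Set.biUnion_subset_biUnion_left hTS
  refine (localEntropy_le f T U (fun a ha => hU a (hTS ha))
    ((orbitCount_mono f hsub).trans_lt hfin)).trans_lt (lt_of_le_of_lt ?_ hc)
  apply codingEntropy_mono f hp <;> simpa only [sUnion_imageFamily]

lemma isSingularSet_singleton {X : Type*} [TopologicalSpace X] (f : X ≃ₜ X) (a : X) :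
    IsSingularSet f {a} := by
  intro U hU M
  refine ⟨a, fun _ => 0, fun b hb => ?_, fun b hb c hc hbc => ?_⟩
  · rw [Finset.mem_singleton.1 hb]
    exact mem_of_mem_nhds (hU a (Finset.mem_singleton_self a))
  · exact absurd ((Finset.mem_singleton.1 hb).trans (Finset.mem_singleton.1 hc).symm) hbc

/-- Every orbit segment visits the family `U` only at times `M`-close to its visits to some
subfamily indexed by `T`, where either `T` is a singleton or the orbit visits the sets `U a`,
`a ∈ T`, at pairwise `M`-separated times. -/
lemma exists_dense_visits {X : Type*} [TopologicalSpace X] (f : X ≃ₜ X) (S : Finset X)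
    (hS : S.Nonempty) (U : X → Set X) (M : ℕ) (n : ℕ) (x : X) :
    ∃ T ⊆ S, T.Nonempty ∧
      ((∃ a, T = {a}) ∨ ∃ N : X → ℤ, (∀ a ∈ T, zIter f (N a) x ∈ U a) ∧
        ∀ a ∈ T, ∀ b ∈ T, a ≠ b → (M : ℤ) < |N a - N b|) ∧
      ∀ k < n, f^[k] x ∈ ⋃ a ∈ S, U a →
        ∃ j < n, f^[j] x ∈ ⋃ a ∈ T, U a ∧ k ≤ j + M ∧ j ≤ k + M := by
  classical
  let C := S.powerset.filter fun T => ∃ N : X → ℕ, (∀ a ∈ T, N a < n ∧ f^[N a] x ∈ U a) ∧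
    ∀ a ∈ T, ∀ b ∈ T, a ≠ b → (M : ℤ) < |(N a : ℤ) - N b|
  have hC : C.Nonempty := ⟨∅, by simp [C]⟩
  obtain ⟨T, hT, hmax⟩ := Finset.exists_max_image C Finset.card hC
  simp only [C, Finset.mem_filter, Finset.mem_powerset] at hT hmax
  obtain ⟨hTS, N, hN, hsep⟩ := hT
  have hdense : ∀ k < n, f^[k] x ∈ ⋃ a ∈ S, U a →
      ∃ j < n, f^[j] x ∈ ⋃ a ∈ T, U a ∧ k ≤ j + M ∧ j ≤ k + M := by
    intro k hk hx
    simp only [Set.mem_iUnion] at hx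
    obtain ⟨b, hb, hxb⟩ := hx
    by_cases hbT : b ∈ T
    · exact ⟨k, hk, Set.mem_biUnion hbT hxb, by simp, by simp⟩
    by_contra hno
    have hfar : ∀ a ∈ T, (M : ℤ) < |(N a : ℤ) - k| := by
      intro a ha
      by_contra hle
      rw [not_lt, abs_le] at hle
      exact hno ⟨N a, (hN a ha).1, Set.mem_biUnion ha (hN a ha).2, by omega, by omega⟩
    have hne : ∀ a ∈ T, a ≠ b := fun a ha h => hbT (h ▸ ha)
    have := hmax (insert b T) ⟨Finset.insert_subset hb hTS, Function.update N b k, ?_, ?_⟩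
    · rw [Finset.card_insert_of_notMem hbT] at this
      omega
    · intro a ha
      rcases Finset.mem_insert.1 ha with rfl | ha
      · simpa using ⟨hk, hxb⟩
      · simpa [Function.update_of_ne (hne a ha)] using hN a ha
    · intro a ha c hc hac
      rcases Finset.mem_insert.1 ha with hab | haT <;>
        rcases Finset.mem_insert.1 hc with hcb | hcT
      · exact absurd (hab.trans hcb.symm) hac
      · rw [hab, Function.update_self, Function.update_of_ne (hne c hcT), abs_sub_comm]
        exact hfar c hcT
      · rw [hcb, Function.update_self, Function.update_of_ne (hne a haT)]
        exact hfar a haT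
      · rw [Function.update_of_ne (hne c hcT), Function.update_of_ne (hne a haT)]
        exact hsep a haT c hcT hac
  rcases T.eq_empty_or_nonempty with rfl | hTne
  · obtain ⟨a, ha⟩ := hS
    refine ⟨{a}, by simpa using ha, by simp, Or.inl ⟨a, rfl⟩, fun k hk hx => ?_⟩
    obtain ⟨j, -, hj, -⟩ := hdense k hk hx
    simp at hj
  · refine ⟨T, hTS, hTne, Or.inr ⟨fun a => N a, fun a ha => ?_, hsep⟩, hdense⟩
    rw [zIter_natCast]
    exact (hN a ha).2

/-- polynomial entropy comes from singular sets: for every nonempty finite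
`S ⊆ X ∖ {∞}`, `h^loc_pol(f; S)` is the maximum of `h^loc_pol(f; S')` over the nonempty
singular subsets `S'` of `S`. -/
theorem localEntropy_eq_max_over_singular {X : Type*} [MetricSpace X] [CompactSpace X]
    (f : X ≃ₜ X) (p : X) (hst : StandingSetting f p)
    (S : Finset X) (hSne : S.Nonempty) (hSp : ∀ a ∈ S, a ≠ p) :
    (∃ S' ⊆ S, S'.Nonempty ∧ IsSingularSet f S' ∧
        localEntropy f S' = localEntropy f S) ∧
      ∀ T ⊆ S, T.Nonempty → IsSingularSet f T →
        localEntropy f T ≤ localEntropy f S := by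
  classical
  have hp := hst.1
  refine ⟨?_, fun T hT _ _ => localEntropy_mono f hp hT⟩
  by_contra! hne
  have hlt : ∀ T ⊆ S, T.Nonempty → IsSingularSet f T → localEntropy f T < localEntropy f S :=
    fun T hT hTne hs => lt_of_le_of_ne (localEntropy_mono f hp hT) (hne T hT hTne hs)
  have hchoice : ∀ T : Finset X, ∃ (V : X → Set X) (M : ℕ), (∀ a ∈ T, V a ∈ 𝓝 a) ∧
      (T ⊆ S → T.Nonempty → IsSingularSet f T → orbitCount f (⋃ a ∈ T, V a) < ⊤ ∧
        codingEntropy f (imageFamily V T) < localEntropy f S) ∧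
      (¬ IsSingularSet f T → ¬ ∃ (x : X) (N : X → ℤ), (∀ a ∈ T, zIter f (N a) x ∈ V a) ∧
        ∀ a ∈ T, ∀ b ∈ T, a ≠ b → (M : ℤ) < |N a - N b|) := by
    intro T
    by_cases hs : IsSingularSet f T
    · by_cases hT : T ⊆ S ∧ T.Nonempty
      · obtain ⟨V, hV, hfin, hc⟩ := exists_of_localEntropy_lt f T (hlt T hT.1 hT.2 hs)
        exact ⟨V, 0, hV, fun _ _ _ => ⟨hfin, hc⟩, fun h => absurd hs h⟩
      · exact ⟨fun _ => Set.univ, 0, fun _ _ => univ_mem,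
          fun h1 h2 => absurd ⟨h1, h2⟩ hT, fun h => absurd hs h⟩
    · have hs' := hs
      simp only [IsSingularSet, MutuallySingularFam, not_forall] at hs'
      obtain ⟨V, hV, M, hM⟩ := hs'
      exact ⟨V, M, hV, fun _ _ h => absurd h hs, fun _ => hM⟩
  choose V m hV hVs hVn using hchoice
  let U : X → Set X := fun a => ⋂ T ∈ S.powerset.filter (a ∈ ·), V T a
  let M : ℕ := S.powerset.sup m
  have hUV : ∀ T ⊆ S, ∀ a ∈ T, U a ⊆ V T a := fun T hT a ha =>
    Set.biInter_subset_of_mem (t := fun T => V T a)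
      (Finset.mem_coe.2 (Finset.mem_filter.2 ⟨Finset.mem_powerset.2 hT, ha⟩))
  have hU : ∀ a ∈ S, U a ∈ 𝓝 a := fun a _ =>
    (Filter.biInter_finset_mem _).2 fun T hT => hV T a (Finset.mem_filter.1 hT).2
  have hfin : orbitCount f (⋃ a ∈ S, U a) < ⊤ := by
    refine orbitCount_biUnion_lt_top f S U fun a ha => ?_
    have haS : {a} ⊆ S := Finset.singleton_subset_iff.2 ha
    refine (orbitCount_mono f ?_).trans_lt
      (hVs {a} haS (Finset.singleton_nonempty a) (isSingularSet_singleton f a)).1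
    exact (hUV {a} haS a (Finset.mem_singleton_self a)).trans
      (Set.subset_biUnion_of_mem (u := V {a}) (Finset.mem_singleton_self a))
  let I := S.powerset.filter fun T => T.Nonempty ∧ IsSingularSet f T
  obtain ⟨T, hT, hle⟩ := codingEntropy_le_of_visits f hp (imageFamily U S) I (imageFamily U) M
    (by rwa [sUnion_imageFamily])
    (fun T hT => by
      rw [sUnion_imageFamily]
      exact (orbitCount_mono f (Set.biUnion_subset_biUnion_left
        (Finset.mem_powerset.1 (Finset.mem_filter.1 hT).1))).trans_lt hfin)
    (fun n x => by
      obtain ⟨T, hTS, hTne, hT, hvis⟩ := exists_dense_visits f S hSne U M n x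
      refine ⟨T, Finset.mem_filter.2 ⟨Finset.mem_powerset.2 hTS, hTne, ?_⟩,
        by simpa only [sUnion_imageFamily] using hvis⟩
      rcases hT with ⟨a, rfl⟩ | ⟨N, hN, hsep⟩
      · exact isSingularSet_singleton f a
      · by_contra hs
        refine hVn T hs ⟨x, N, fun a ha => hUV T hTS a ha (hN a ha),
          fun a ha b hb hab => lt_of_le_of_lt ?_ (hsep a ha b hb hab)⟩
        exact_mod_cast Finset.le_sup (f := m) (Finset.mem_powerset.2 hTS))
  obtain ⟨hTS, hTne, hs⟩ := Finset.mem_filter.1 hT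
  rw [Finset.mem_powerset] at hTS
  obtain ⟨hTfin, hTlt⟩ := hVs T hTS hTne hs
  refine absurd (localEntropy_le f S U hU hfin) (not_le.2 (lt_of_le_of_lt (hle.trans ?_) hTlt))
  refine codingEntropy_mono f hp ?_ (by rwa [sUnion_imageFamily])
  rw [sUnion_imageFamily, sUnion_imageFamily]
  exact Set.biUnion_mono subset_rfl (hUV T hTS)
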